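/- Let ξ(x) be the inverse function of x(ξ) = π^{-1/n} ∫₀^ξ (cosh(πs))^{1/n} ds. Then as x → +∞: ξ(x) = π^{-1} n (ln(a₀ x) - a₁ x^{-1} + O(x^{-2})), ξ'(x) = π^{-1} n x^{-1}(1 + a₁ x^{-1} + O(x^{-2})), and ξ''(x) = -π^{-1} n x^{-2}(1 + O(x^{-1})), where a₀ = π (2π)^{1/n} n^{-1} and a₁ is the constant from the asymptotics of x(ξ). -/

import Mathlib

open Real in
lemma deriv_part (n : ℕ) (hn : 1 ≤ n) (x : ℝ → ℝ)
    (hx : ∀ ξ : ℝ, x ξ =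
      Real.pi ^ (-(1:ℝ) / (n:ℝ)) * ∫ s in (0:ℝ)..ξ, Real.cosh (Real.pi * s) ^ ((1:ℝ) / (n:ℝ)))
    (xi : ℝ → ℝ) (hinv1 : Function.LeftInverse xi x) (hinv2 : Function.RightInverse xi x)
    (f : ℝ → ℝ) (hf : f = fun s => π ^ (-(1:ℝ) / (n:ℝ)) * cosh (π * s) ^ ((1:ℝ) / (n:ℝ))) :
    Monotone xi ∧ (∀ t, deriv xi t = (f (xi t))⁻¹) ∧
    ∀ t, deriv (deriv xi) t = -(π / n) * tanh (π * xi t) * ((f (xi t))⁻¹)^2 := by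
  have hn0 : (0:ℝ) < n := by exact_mod_cast hn
  have hcont : Continuous (fun s : ℝ => cosh (π * s) ^ ((1:ℝ) / (n:ℝ))) := by
    apply Continuous.rpow_const
    · fun_prop
    · intro s; left; exact (cosh_pos _).ne'
  have hfpos : ∀ s, 0 < f s := by
    intro s; rw [hf]
    exact mul_pos (rpow_pos_of_pos pi_pos _) (rpow_pos_of_pos (cosh_pos _) _)
  have hxd : ∀ s, HasDerivAt x (f s) s := by
    intro s
    have h := (intervalIntegral.integral_hasDerivAt_right (hcont.intervalIntegrable 0 s)
      (hcont.stronglyMeasurableAtFilter _ _) hcont.continuousAt).const_mul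
      (π ^ (-(1:ℝ) / (n:ℝ)))
    rw [hf]
    rw [show x = _ from funext hx]
    exact h
  have hxm : StrictMono x := strictMono_of_deriv_pos fun s => by
    rw [(hxd s).deriv]; exact hfpos s
  have hm : Monotone xi := by
    intro a b hab
    apply hxm.le_iff_le.mp
    rw [hinv2 a, hinv2 b]; exact hab
  have hc : Continuous xi := hm.continuous_of_surjective hinv1.surjective
  have hxid : ∀ t, HasDerivAt xi (f (xi t))⁻¹ t := fun t =>
    HasDerivAt.of_local_left_inverse hc.continuousAt (hxd _) (hfpos _).ne'
      (Filter.Eventually.of_forall hinv2)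
  have hd : deriv xi = fun t => (f (xi t))⁻¹ := funext fun t => (hxid t).deriv
  have hfd : ∀ s, HasDerivAt f (f s * (π / n) * tanh (π * s)) s := by
    intro s
    have h1 : HasDerivAt (fun s => cosh (π * s)) (sinh (π * s) * (π * 1)) s :=
      ((hasDerivAt_id s).const_mul π).cosh
    have h2 := (h1.rpow_const (p := (1:ℝ)/n) (Or.inl (cosh_pos _).ne')).const_mul
      (π ^ (-(1:ℝ) / (n:ℝ)))
    rw [hf]
    refine h2.congr_deriv ?_
    rw [tanh_eq_sinh_div_cosh, rpow_sub_one (cosh_pos _).ne']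
    have := (cosh_pos (π * s)).ne'
    field_simp
  refine ⟨hm, fun t => (hxid t).deriv, fun t => ?_⟩
  rw [hd]
  have h3 := (((hfd (xi t)).comp t (hxid t)).inv (hfpos _).ne')
  have h4 := h3.deriv
  have : deriv (fun t => (f (xi t))⁻¹) t = _ := h4
  rw [this]
  have := (hfpos (xi t)).ne'
  simp only [Function.comp]
  field_simp

open Real in
lemma f_inv (n : ℕ) (hn : 1 ≤ n) (s : ℝ) :
    (π ^ (-(1:ℝ) / (n:ℝ)) * cosh (π * s) ^ ((1:ℝ) / (n:ℝ)))⁻¹ =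
    (2 * π) ^ ((1:ℝ) / (n:ℝ)) * (exp (π * s / n))⁻¹ *
      ((1 + exp (-(2 * π * s))) ^ ((1:ℝ) / (n:ℝ)))⁻¹ := by
  have hn0 : (0:ℝ) < n := by exact_mod_cast hn
  have h1 : cosh (π * s) = exp (π * s) * (1 + exp (-(2 * π * s))) / 2 := by
    rw [cosh_eq, mul_add, ← exp_add]; ring_nf
  have hp : (0:ℝ) < 1 + exp (-(2 * π * s)) := by positivity
  rw [h1, div_rpow (by positivity) (by norm_num), mul_rpow (exp_pos _).le hp.le,
    mul_rpow (by norm_num) pi_pos.le, neg_div, rpow_neg pi_pos.le, ← exp_mul]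
  have : π * s * (1 / n) = π * s / n := by ring
  rw [this]
  simp only [mul_inv, inv_inv, div_eq_mul_inv]
  ring

lemma arith (a₁ C A t E : ℝ) (hC : 0 < C) (hA : 0 < A) (hE : 1 ≤ E)
    (h : |t - A * E - a₁| ≤ C * E⁻¹) (ht1 : 1 ≤ t) (ht2 : 2 * (|a₁| + C) ≤ t)
    (ht3 : 2 * (|a₁| + 2 * A * C) ≤ t) :
    E⁻¹ ≤ 2 * A * t⁻¹ ∧ |A * E * t⁻¹ - 1 + a₁ * t⁻¹| ≤ 2 * A * C * (t⁻¹)^2 ∧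
    |A * E * t⁻¹ - 1| ≤ (|a₁| + 2 * A * C) * t⁻¹ ∧ |A * E * t⁻¹ - 1| ≤ 1/2 := by
  have ht0 : 0 < t := by linarith
  have hE0 : 0 < E := by linarith
  have hEi : E⁻¹ ≤ 1 := inv_le_one_of_one_le₀ hE
  have hu : 0 < t⁻¹ := by positivity
  have hu1 : t⁻¹ ≤ 1 := inv_le_one_of_one_le₀ ht1
  have htu : t * t⁻¹ = 1 := mul_inv_cancel₀ ht0.ne'
  have h1 : t / 2 ≤ A * E := by
    have := (abs_le.mp h).2
    have := le_abs_self a₁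
    nlinarith
  have g1 : E⁻¹ ≤ 2 * A * t⁻¹ := by
    rw [inv_le_iff_one_le_mul₀ hE0]
    have := mul_le_mul_of_nonneg_right h1 hu.le
    nlinarith
  have g2 : |A * E * t⁻¹ - 1 + a₁ * t⁻¹| ≤ 2 * A * C * (t⁻¹)^2 := by
    have e : A * E * t⁻¹ - 1 + a₁ * t⁻¹ = -((t - A * E - a₁) * t⁻¹) := by
      linear_combination htu
    rw [e, abs_neg, abs_mul, abs_of_pos hu]
    calc _ ≤ C * E⁻¹ * t⁻¹ := by gcongr
      _ ≤ C * (2 * A * t⁻¹) * t⁻¹ := by gcongr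
      _ = _ := by ring
  have g3 : |A * E * t⁻¹ - 1| ≤ (|a₁| + 2 * A * C) * t⁻¹ := by
    have e : A * E * t⁻¹ - 1 = (A * E * t⁻¹ - 1 + a₁ * t⁻¹) - a₁ * t⁻¹ := by ring
    rw [e]
    refine (abs_sub _ _).trans ?_
    rw [abs_mul, abs_of_pos hu]
    have : (t⁻¹)^2 ≤ t⁻¹ := by nlinarith
    have : 2 * A * C * (t⁻¹)^2 ≤ 2 * A * C * t⁻¹ := by gcongr
    linarith
  refine ⟨g1, g2, g3, g3.trans ?_⟩
  have := mul_le_mul_of_nonneg_right ht3 hu.le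
  nlinarith

lemma core2 (a₁ u w p r τ q K M Q : ℝ) (hu : 0 < u) (hu1 : u ≤ 1) (hpw : p * w = 1)
    (hK : 0 ≤ K) (hQ : 0 ≤ Q)
    (hw1 : |w - 1 + a₁ * u| ≤ K * u ^ 2) (hw2 : |w - 1| ≤ M * u) (hw3 : |w - 1| ≤ 1 / 2)
    (hq : q ≤ Q * u ^ 2) (hr1 : r ≤ 1) (hr : 1 - r ≤ q) (hr0 : 0 < r) (ht1 : τ ≤ 1)
    (ht : 1 - τ ≤ 2 * q) :
    |Real.log w + a₁ * u| ≤ (2 * M ^ 2 + K) * u ^ 2 ∧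
    |p * r - 1 - a₁ * u| ≤ (2 * M ^ 2 + K + 2 * Q) * u ^ 2 ∧
    |τ * (p * r) ^ 2 - 1| ≤ (3 * (|a₁| + 2 * M ^ 2 + K + 2 * Q) + 8 * Q) * u := by
  have hwb := abs_le.mp hw3
  have hw0 : 0 < w := by linarith [hwb.1]
  have hp : p = w⁻¹ := eq_inv_of_mul_eq_one_left hpw
  have hp0 : 0 < p := by rw [hp]; positivity
  have hp2 : p ≤ 2 := by nlinarith [hwb.1]
  have hsq : (w - 1) ^ 2 ≤ M ^ 2 * u ^ 2 := by
    rw [← sq_abs, ← mul_pow]; gcongr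
  have hz : p - 1 + (w - 1) = p * (w - 1) ^ 2 := by linear_combination (2 - w) * hpw
  have hz1 : p * (w - 1) ^ 2 ≤ 2 * M ^ 2 * u ^ 2 := by
    have := mul_le_mul hp2 hsq (sq_nonneg _) (by norm_num)
    linarith
  have hz0 : 0 ≤ p * (w - 1) ^ 2 := by positivity
  have l1 := Real.log_le_sub_one_of_pos hw0
  have l2 := Real.one_sub_inv_le_log_of_pos hw0
  rw [← hp] at l2
  have hb := abs_le.mp hw1
  have g2' : |p * r - 1 - a₁ * u| ≤ (2 * M ^ 2 + K + 2 * Q) * u ^ 2 := by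
    have h1 : p * (1 - r) ≤ 2 * (Q * u ^ 2) :=
      mul_le_mul hp2 (hr.trans hq) (by linarith) (by norm_num)
    have h0 : 0 ≤ p * (1 - r) := mul_nonneg hp0.le (by linarith)
    have : 0 ≤ Q * u ^ 2 := by positivity
    have : 0 ≤ M ^ 2 * u ^ 2 := by positivity
    rw [abs_le]; constructor <;> nlinarith [hb.1, hb.2]
  refine ⟨?_, g2', ?_⟩
  · have : 0 ≤ M ^ 2 * u ^ 2 := by positivity
    rw [abs_le]; constructor <;> nlinarith [hb.1, hb.2]
  · have huu : u ^ 2 ≤ u := by nlinarith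
    have hv : |p * r - 1| ≤ (|a₁| + 2 * M ^ 2 + K + 2 * Q) * u := by
      have e : p * r - 1 = (p * r - 1 - a₁ * u) + a₁ * u := by ring
      rw [e]
      refine (abs_add_le _ _).trans ?_
      rw [abs_mul a₁ u, abs_of_pos hu]
      have : (2 * M ^ 2 + K + 2 * Q) * u ^ 2 ≤ (2 * M ^ 2 + K + 2 * Q) * u := by gcongr
      linarith
    have hv0 : 0 < p * r := by positivity
    have hv2 : p * r ≤ 2 := by nlinarith
    have e : τ * (p * r) ^ 2 - 1 = (p * r - 1) * (p * r + 1) - (1 - τ) * (p * r) ^ 2 := by ring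
    rw [e]
    refine (abs_sub _ _).trans ?_
    rw [abs_mul, abs_mul, abs_of_pos (by linarith : 0 < p * r + 1),
      abs_of_nonneg (by linarith : 0 ≤ 1 - τ), abs_of_nonneg (sq_nonneg (p * r))]
    have k1 : |p * r - 1| * (p * r + 1) ≤ (|a₁| + 2 * M ^ 2 + K + 2 * Q) * u * 3 :=
      mul_le_mul hv (by linarith) (by linarith) (by positivity)
    have k2 : (1 - τ) * (p * r) ^ 2 ≤ (2 * (Q * u)) * 4 := by
      apply mul_le_mul
      · have : Q * u ^ 2 ≤ Q * u := by gcongr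
        linarith
      · nlinarith
      · positivity
      · positivity
    linarith

set_option maxHeartbeats 1000000 in
/-- Asymptotics of the inverse `ξ(x)` of `x(ξ) = π^{-1/n} ∫₀^ξ cosh(πs)^{1/n} ds` as
`x → +∞`: `ξ(x) = π⁻¹ n (ln(a₀x) - a₁/x + O(x⁻²))`,
`ξ'(x) = π⁻¹ n x⁻¹ (1 + a₁/x + O(x⁻²))`, `ξ''(x) = -π⁻¹ n x⁻² (1 + O(x⁻¹))`. -/
theorem stmt_11 (n : ℕ) (hn : 1 ≤ n) (x : ℝ → ℝ)
    (hx : ∀ ξ : ℝ, x ξ =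
      Real.pi ^ (-(1:ℝ) / (n:ℝ)) * ∫ s in (0:ℝ)..ξ, Real.cosh (Real.pi * s) ^ ((1:ℝ) / (n:ℝ)))
    (xi : ℝ → ℝ) (hinv1 : Function.LeftInverse xi x) (hinv2 : Function.RightInverse xi x)
    (a₀ a₁ : ℝ) (ha₀ : a₀ = Real.pi * (2 * Real.pi) ^ ((1:ℝ) / (n:ℝ)) / (n:ℝ))
    (ha₁ : ∃ C > (0:ℝ), ∃ R : ℝ, ∀ ξ : ℝ, R ≤ ξ →
      |x ξ - a₀⁻¹ * Real.exp (Real.pi * ξ / (n:ℝ)) - a₁| ≤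
        C * Real.exp (-(Real.pi * (2 * (n:ℝ) - 1) * ξ) / (n:ℝ))) :
    ∃ C > (0:ℝ), ∃ R : ℝ, ∀ t : ℝ, R ≤ t →
      |xi t - (n:ℝ) / Real.pi * (Real.log (a₀ * t) - a₁ / t)| ≤ C * t ^ (-(2:ℝ)) ∧
      |deriv xi t - (n:ℝ) / Real.pi * t⁻¹ * (1 + a₁ / t)| ≤ C * t ^ (-(3:ℝ)) ∧
      |deriv (deriv xi) t + (n:ℝ) / Real.pi * t ^ (-(2:ℝ))| ≤ C * t ^ (-(3:ℝ)) := by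
  obtain ⟨hm, hd1, hd2⟩ := deriv_part n hn x hx xi hinv1 hinv2 _ rfl
  obtain ⟨C, hC, R, hR⟩ := ha₁
  have hn1 : (1:ℝ) ≤ n := by exact_mod_cast hn
  have hn0 : (0:ℝ) < n := by linarith
  have hpi := Real.pi_pos
  have ha0 : 0 < a₀ := by rw [ha₀]; positivity
  set A := a₀⁻¹ with hA
  have hA0 : 0 < A := by positivity
  obtain ⟨K, hK⟩ : ∃ K, K = 2 * A * C := ⟨_, rfl⟩
  obtain ⟨M, hM⟩ : ∃ M, M = |a₁| + 2 * A * C := ⟨_, rfl⟩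
  obtain ⟨Q, hQ⟩ : ∃ Q, Q = (2 * A) ^ 2 := ⟨_, rfl⟩
  have hK0 : 0 < K := by rw [hK]; positivity
  have hQ0 : 0 ≤ Q := by rw [hQ]; positivity
  refine ⟨n / Real.pi * (3 * (|a₁| + 2 * M ^ 2 + K + 2 * Q) + 8 * Q), by positivity,
    max (x (max R 0)) (max 1 (max (2 * (|a₁| + C)) (2 * (|a₁| + 2 * A * C)))), ?_⟩
  intro t ht
  simp only [max_le_iff] at ht
  obtain ⟨htx, ht1, ht2, ht3⟩ := ht
  have hxi : max R 0 ≤ xi t := by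
    have := hm htx
    rwa [hinv1] at this
  have hxiR := (le_max_left _ _).trans hxi
  have hxi0 := (le_max_right _ _).trans hxi
  have hb := hR _ hxiR
  rw [hinv2 t] at hb
  have ht0 : 0 < t := by linarith
  have hd1 := hd1 t
  have hd2 := hd2 t
  rw [f_inv n hn] at hd1 hd2
  obtain ⟨s, hs⟩ : ∃ s, s = xi t := ⟨_, rfl⟩
  obtain ⟨E, hE⟩ : ∃ E, E = Real.exp (Real.pi * s / n) := ⟨_, rfl⟩
  rw [← hs] at hb hd1 hd2 hxi0
  have hE1 : 1 ≤ E := by rw [hE]; apply Real.one_le_exp; positivity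
  have hE0 : 0 < E := by linarith
  have hEinv : E⁻¹ = Real.exp (-(Real.pi * s / n)) := by rw [hE, Real.exp_neg]
  have hb' : |t - A * E - a₁| ≤ C * E⁻¹ := by
    rw [hE]
    refine hb.trans ?_
    rw [← Real.exp_neg]
    gcongr
    rw [neg_div]
    apply neg_le_neg
    gcongr
    nlinarith [mul_nonneg hpi.le hxi0]
  obtain ⟨g1, g2, g3, g4⟩ := arith a₁ C A t E hC hA0 hE1 hb' ht1 ht2 ht3
  obtain ⟨q, hq⟩ : ∃ q, q = Real.exp (-(2 * Real.pi * s)) := ⟨_, rfl⟩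
  have hq0 : 0 < q := by rw [hq]; positivity
  have hqQ : q ≤ Q * (t⁻¹) ^ 2 := by
    have h1 : q ≤ (E⁻¹) ^ 2 := by
      rw [hEinv, hq, ← Real.exp_nat_mul]
      apply Real.exp_le_exp.mpr
      have : Real.pi * s / n ≤ Real.pi * s := div_le_self (by positivity) hn1
      push_cast
      linarith
    rw [hQ, ← mul_pow]
    exact h1.trans (by gcongr)
  rw [← hE, ← hq] at hd1 hd2
  obtain ⟨b, hbq⟩ : ∃ b, b = (1 + q) ^ ((1:ℝ) / n) := ⟨_, rfl⟩
  have hb1 : 1 ≤ b := by rw [hbq]; apply Real.one_le_rpow <;> [linarith; positivity]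
  have hb2 : b ≤ 1 + q := by
    rw [hbq]
    calc _ ≤ (1 + q) ^ (1:ℝ) := by
          apply Real.rpow_le_rpow_of_exponent_le (by linarith)
          rw [div_le_one hn0]; exact hn1
      _ = _ := Real.rpow_one _
  have hb0 : 0 < b := by linarith
  rw [← hbq] at hd1 hd2
  have hr1 : b⁻¹ ≤ 1 := inv_le_one_of_one_le₀ hb1
  have hr : 1 - b⁻¹ ≤ q := by
    have : b * b⁻¹ = 1 := mul_inv_cancel₀ hb0.ne'
    nlinarith [inv_pos.mpr hb0]
  have hu : 0 < t⁻¹ := by positivity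
  have hτ : Real.tanh (Real.pi * s) = (1 - q) / (1 + q) := by
    have hc : Real.exp (-(Real.pi * s)) = Real.exp (Real.pi * s) * q := by
      rw [hq, ← Real.exp_add]; ring_nf
    rw [Real.tanh_eq_sinh_div_cosh, Real.sinh_eq, Real.cosh_eq, hc]
    have := Real.exp_pos (Real.pi * s)
    field_simp
  have hτ1 : Real.tanh (Real.pi * s) ≤ 1 := by
    rw [hτ, div_le_one (by linarith)]; linarith
  have hτ2 : 1 - Real.tanh (Real.pi * s) ≤ 2 * q := by
    rw [hτ, sub_le_iff_le_add, ← sub_le_iff_le_add', le_div_iff₀ (by linarith)]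
    nlinarith
  have hpw : (a₀ * t * E⁻¹) * (A * E * t⁻¹) = 1 := by
    rw [hA]; field_simp
  obtain ⟨k1, k2, k3⟩ := core2 a₁ t⁻¹ (A * E * t⁻¹) (a₀ * t * E⁻¹) b⁻¹ (Real.tanh (Real.pi * s))
    q K M Q hu (inv_le_one_of_one_le₀ ht1) hpw hK0.le hQ0 (by rw [hK]; exact g2) (by rw [hM]; exact g3) g4 hqQ hr1 hr
    (inv_pos.mpr hb0) hτ1 hτ2
  have e2 : t ^ (-(2:ℝ)) = (t⁻¹) ^ 2 := by
    rw [Real.rpow_neg ht0.le, inv_pow]; norm_cast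
  have e3 : t ^ (-(3:ℝ)) = (t⁻¹) ^ 3 := by
    rw [Real.rpow_neg ht0.le, inv_pow]; norm_cast
  rw [e2, e3]
  have hnp : 0 < n / Real.pi := by positivity
  have hpos := abs_nonneg a₁
  have hM2 := sq_nonneg M
  have hfd : (2 * Real.pi) ^ ((1:ℝ) / n) * E⁻¹ * b⁻¹
      = n / Real.pi * t⁻¹ * ((a₀ * t * E⁻¹) * b⁻¹) := by
    have : (2 * Real.pi) ^ ((1:ℝ) / n) = n / Real.pi * a₀ := by
      rw [ha₀]; field_simp
    rw [this]; field_simp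
  rw [hfd] at hd1 hd2
  refine ⟨?_, ?_, ?_⟩
  · have hlog : Real.log (A * E * t⁻¹) = Real.pi * s / n - Real.log (a₀ * t) := by
      have : A * E * t⁻¹ = E / (a₀ * t) := by rw [hA]; field_simp
      rw [this, Real.log_div hE0.ne' (by positivity), hE, Real.log_exp]
    have e : xi t - n / Real.pi * (Real.log (a₀ * t) - a₁ / t)
        = n / Real.pi * (Real.log (A * E * t⁻¹) + a₁ * t⁻¹) := by
      rw [hlog, ← hs]; field_simp; ring
    rw [e, abs_mul, abs_of_pos hnp, mul_assoc (n / Real.pi)]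
    refine mul_le_mul_of_nonneg_left (k1.trans ?_) hnp.le
    exact mul_le_mul_of_nonneg_right (by linarith) (by positivity)
  · rw [hd1]
    have e : n / Real.pi * t⁻¹ * (a₀ * t * E⁻¹ * b⁻¹) - n / Real.pi * t⁻¹ * (1 + a₁ / t)
        = n / Real.pi * t⁻¹ * (a₀ * t * E⁻¹ * b⁻¹ - 1 - a₁ * t⁻¹) := by
      rw [div_eq_mul_inv a₁ t]; ring
    rw [e, abs_mul, abs_of_pos (by positivity)]
    calc _ ≤ n / Real.pi * t⁻¹ * ((2 * M ^ 2 + K + 2 * Q) * (t⁻¹) ^ 2) := by gcongr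
      _ = n / Real.pi * (2 * M ^ 2 + K + 2 * Q) * (t⁻¹) ^ 3 := by ring
      _ ≤ _ := mul_le_mul_of_nonneg_right
          (mul_le_mul_of_nonneg_left (by linarith) hnp.le) (by positivity)
  · rw [hd2]
    generalize a₀ * t * E⁻¹ * b⁻¹ = v at *
    generalize Real.tanh (Real.pi * s) = τ at *
    have e : -(Real.pi / n) * τ * (n / Real.pi * t⁻¹ * v) ^ 2 + n / Real.pi * (t⁻¹) ^ 2
        = -(n / Real.pi * (t⁻¹) ^ 2 * (τ * v ^ 2 - 1)) := by
      field_simp; ring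
    rw [e, abs_neg, abs_mul, abs_of_pos (by positivity)]
    calc _ ≤ n / Real.pi * (t⁻¹) ^ 2 * ((3 * (|a₁| + 2 * M ^ 2 + K + 2 * Q) + 8 * Q) * t⁻¹) := by
          gcongr
      _ = _ := by ring
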